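/- The class P₁ is closed under classical convolution: if μ₁, μ₂ ∈ P₁, then μ₁ * μ₂ ∈ P₁. -/

import Mathlib

open MeasureTheory Complex

/-- Condition (A2): the density `p` has the form `p x = ∑ₙ aₙ/xⁿ` (with `a₀ = a₁ = 0`),
absolutely convergent for `|x| > r`, and `p` is nonnegative on `|x| ≥ R`. -/
structure A2 (p : ℝ → ℝ) (a : ℕ → ℝ) (r R : ℝ) : Prop where
  hr : 0 < r
  hrR : r < R
  ha0 : a 0 = 0
  ha1 : a 1 = 0
  hsum : ∀ x : ℝ, r < |x| → HasSum (fun n => a n / x ^ n) (p x)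
  habs : ∀ x : ℝ, r < |x| → Summable (fun n => |a n| / |x| ^ n)
  hpos : ∀ x : ℝ, R ≤ |x| → 0 ≤ p x

/-- The measure `λ(dx) = p(x) 1_{|x| ≥ R} dx`. -/
noncomputable def tailMeasure (p : ℝ → ℝ) (R : ℝ) : Measure ℝ :=
  volume.withDensity (fun x => ENNReal.ofReal (if R ≤ |x| then p x else 0))

/-- The complex extension `p(z) = ∑ₙ aₙ/zⁿ` of the density. -/
noncomputable def pC (a : ℕ → ℝ) (z : ℂ) : ℂ := ∑' n : ℕ, (a n : ℂ) / z ^ n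

/-- The complex extension of `u ↦ p(1/u)`, i.e. `∑ₙ aₙ uⁿ`. -/
noncomputable def pCInv (a : ℕ → ℝ) (u : ℂ) : ℂ := ∑' n : ℕ, (a n : ℂ) * u ^ n

/-- Contour integral over the circular arc of radius `c` centred at `0`,
with angle running from `θ₁` to `θ₂`. -/
noncomputable def arcInt (θ₁ θ₂ c : ℝ) (f : ℂ → ℂ) : ℂ :=
  ∫ θ in θ₁..θ₂, (Complex.I * c * Complex.exp (θ * Complex.I)) *
    f (c * Complex.exp (θ * Complex.I))

/-- The Stieltjes transform of a measure on `ℝ`. -/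
noncomputable def stieltjes (μ : Measure ℝ) (z : ℂ) : ℂ :=
  ∫ x, (z - x)⁻¹ ∂μ

/-- The class `P₁`: probability measures of the form `ν + λ` with `ν` a compactly supported
positive measure and `λ` satisfying (A2). -/
def memP1 (μ : Measure ℝ) : Prop :=
  ∃ (ν : Measure ℝ) (p : ℝ → ℝ) (a : ℕ → ℝ) (r R : ℝ),
    A2 p a r R ∧ (∃ K : Set ℝ, IsCompact K ∧ ν Kᶜ = 0) ∧
    μ = ν + tailMeasure p R

/-- Classical (tensor) convolution of two measures on `ℝ`. -/
noncomputable def mconv (μ ν : Measure ℝ) : Measure ℝ :=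
  (μ.prod ν).map (fun q => q.1 + q.2)

open Set Filter Topology

section Expansion

variable {p : ℝ → ℝ} {a : ℕ → ℝ} {r R : ℝ}

lemma pC_eq_pCInv_inv (a : ℕ → ℝ) (z : ℂ) : pC a z = pCInv a z⁻¹ := by
  simp only [pC, pCInv, inv_pow, div_eq_mul_inv]

lemma A2.summable_abs_div_pow (h : A2 p a r R) {s : ℝ} (hs : r < s) :
    Summable fun n => |a n| / s ^ n := by
  have := h.habs s (by rwa [abs_of_pos (h.hr.trans hs)])
  rwa [abs_of_pos (h.hr.trans hs)] at this

lemma A2.pC_ofReal (h : A2 p a r R) {x : ℝ} (hx : r < |x|) : pC a x = p x := by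
  have := Complex.hasSum_ofReal.2 (h.hsum x hx)
  push_cast at this
  exact this.tsum_eq

lemma A2.norm_pCInv_le (h : A2 p a r R) {s : ℝ} (hs : r < s) :
    ∃ C, 0 ≤ C ∧ ∀ v : ℂ, ‖v‖ ≤ s⁻¹ → ‖pCInv a v‖ ≤ C * ‖v‖ ^ 2 := by
  have hs0 : 0 < s := h.hr.trans hs
  have hsum := h.summable_abs_div_pow hs
  refine ⟨(∑' n, |a n| / s ^ n) * s ^ 2, by positivity, fun v hv => ?_⟩
  rw [mul_assoc, ← tsum_mul_right]
  refine tsum_of_norm_bounded (hsum.mul_right (s ^ 2 * ‖v‖ ^ 2)).hasSum fun n => ?_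
  rcases n with _ | _ | n
  · simp [h.ha0]
  · simp [h.ha1]
  · have h1 : ‖v‖ ^ n ≤ (s⁻¹) ^ n := by gcongr
    calc ‖(a (n + 2) : ℂ) * v ^ (n + 2)‖ = |a (n + 2)| * (‖v‖ ^ n * ‖v‖ ^ 2) := by
          rw [norm_mul, norm_pow, Complex.norm_real, Real.norm_eq_abs, pow_add]
      _ ≤ |a (n + 2)| * ((s⁻¹) ^ n * ‖v‖ ^ 2) := by gcongr
      _ = _ := by rw [inv_pow]; field_simp; ring

lemma A2.norm_pC_le (h : A2 p a r R) :
    ∃ C, 0 ≤ C ∧ ∀ z : ℂ, R ≤ ‖z‖ → ‖pC a z‖ ≤ C / ‖z‖ ^ 2 := by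
  obtain ⟨C, hC, hb⟩ := h.norm_pCInv_le h.hrR
  refine ⟨C, hC, fun z hz => ?_⟩
  have := hb z⁻¹ (by rw [norm_inv]; exact inv_anti₀ (h.hr.trans h.hrR) hz)
  rwa [pC_eq_pCInv_inv, div_eq_mul_inv, ← inv_pow, ← norm_inv]

lemma A2.differentiableOn_pCInv (h : A2 p a r R) {s : ℝ} (hs : r < s) :
    DifferentiableOn ℂ (pCInv a) (Metric.ball 0 s⁻¹) := by
  have hs0 : 0 < s := h.hr.trans hs
  refine differentiableOn_tsum_of_summable_norm (h.summable_abs_div_pow hs)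
    (fun n => by fun_prop) Metric.isOpen_ball fun n v hv => ?_
  have hv' : ‖v‖ ≤ s⁻¹ := by simpa using (mem_ball_zero_iff.1 hv).le
  calc ‖(a n : ℂ) * v ^ n‖ = |a n| * ‖v‖ ^ n := by simp
    _ ≤ |a n| * (s⁻¹) ^ n := by gcongr
    _ = _ := by rw [inv_pow]; rfl

lemma A2.differentiableAt_pC (h : A2 p a r R) {z : ℂ} (hz : r < ‖z‖) :
    DifferentiableAt ℂ (pC a) z := by
  obtain ⟨s, hs, hsz⟩ := exists_between hz
  have hs0 : 0 < s := h.hr.trans hs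
  have hz0 : z ≠ 0 := norm_pos_iff.1 (hs0.trans hsz)
  have h1 : DifferentiableAt ℂ (pCInv a) z⁻¹ :=
    (h.differentiableOn_pCInv hs).differentiableAt <| Metric.isOpen_ball.mem_nhds <| by
      rw [mem_ball_zero_iff, norm_inv]; exact inv_strictAnti₀ hs0 hsz
  have : pC a = fun z => pCInv a z⁻¹ := funext (pC_eq_pCInv_inv a)
  rw [this]
  exact h1.comp z (differentiableAt_inv hz0)

/-- `f` is given, for large `|x|`, by a convergent series `∑ cₙ / xⁿ` with `c₀ = c₁ = 0`. -/
def HasExpansionAtInfty (f : ℝ → ℂ) : Prop :=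
  ∃ (c : ℕ → ℂ) (ρ : ℝ), 0 < ρ ∧ c 0 = 0 ∧ c 1 = 0 ∧
    ∀ x : ℝ, ρ < |x| → HasSum (fun n => c n / (x : ℂ) ^ n) (f x)

lemma HasExpansionAtInfty.add {f g : ℝ → ℂ} (hf : HasExpansionAtInfty f)
    (hg : HasExpansionAtInfty g) : HasExpansionAtInfty fun x => f x + g x := by
  obtain ⟨c, ρ, hρ, hc0, hc1, hc⟩ := hf
  obtain ⟨d, σ, hσ, hd0, hd1, hd⟩ := hg
  refine ⟨fun n => c n + d n, max ρ σ, by positivity, by simp [hc0, hd0], by simp [hc1, hd1],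
    fun x hx => ?_⟩
  simpa only [add_div] using
    (hc x ((le_max_left _ _).trans_lt hx)).add (hd x ((le_max_right _ _).trans_lt hx))

lemma HasExpansionAtInfty.const_mul {f : ℝ → ℂ} (hf : HasExpansionAtInfty f) (k : ℂ) :
    HasExpansionAtInfty fun x => k * f x := by
  obtain ⟨c, ρ, hρ, hc0, hc1, hc⟩ := hf
  exact ⟨fun n => k * c n, ρ, hρ, by simp [hc0], by simp [hc1],
    fun x hx => by simpa only [mul_div_assoc] using (hc x hx).mul_left k⟩

/-- A function which is `O(u²)` and holomorphic near `0` gives, through `u = 1 / x`, an expansion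
at infinity. -/
lemma hasExpansionAtInfty_of_differentiableOn {Φ : ℂ → ℂ} {δ C : ℝ} (hδ : 0 < δ)
    (hΦ : DifferentiableOn ℂ Φ (Metric.ball 0 δ))
    (hC : ∀ u ∈ Metric.ball (0 : ℂ) δ, ‖Φ u‖ ≤ C * ‖u‖ ^ 2) :
    HasExpansionAtInfty fun x => Φ (x : ℂ)⁻¹ := by
  have hmem : Metric.ball (0 : ℂ) δ ∈ 𝓝 0 := Metric.ball_mem_nhds _ hδ
  have hderiv : HasFDerivAt Φ (0 : ℂ →L[ℂ] ℂ) 0 := by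
    refine Asymptotics.IsBigO.hasFDerivAt (n := 2) ?_ one_lt_two
    refine Asymptotics.IsBigO.of_bound C (eventually_of_mem hmem fun u hu => ?_)
    simpa using hC u hu
  have hz : Φ 0 = 0 := by simpa using hC 0 (Metric.mem_ball_self hδ)
  refine ⟨fun n => (n.factorial : ℂ)⁻¹ * iteratedDeriv n Φ 0, δ⁻¹, by positivity, by simp [hz], ?_,
    fun x hx => ?_⟩
  · simp [iteratedDeriv_one, hderiv.hasDerivAt.deriv]
  · have hu : (x : ℂ)⁻¹ ∈ Metric.ball (0 : ℂ) δ := by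
      rw [mem_ball_zero_iff, norm_inv, Complex.norm_real, Real.norm_eq_abs]
      exact inv_lt_of_inv_lt₀ hδ hx
    refine (Complex.hasSum_taylorSeries_on_ball hΦ hu).congr_fun fun n => ?_
    simp only [sub_zero, smul_eq_mul, inv_pow]
    ring

/-- Averages of translates `pC a (x - z)` over `z` in a bounded set are analytic at infinity. -/
lemma A2.hasExpansionAtInfty_integral (h : A2 p a r R) (m : Measure ℝ)
    [IsFiniteMeasureOnCompacts m] {K : Set ℝ} (hK : IsCompact K) {z w : ℝ → ℂ}
    (hz : ContinuousOn z K) (hw : ContinuousOn w K) :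
    HasExpansionAtInfty fun x => ∫ t in K, w t * pC a (x - z t) ∂m := by
  obtain ⟨ρ', hρ'⟩ := hK.exists_bound_of_continuousOn hz
  obtain ⟨W, hW⟩ := hK.exists_bound_of_continuousOn hw
  set ρ : ℝ := max ρ' 1
  have hρ : 0 < ρ := by positivity
  have hzρ : ∀ t ∈ K, ‖z t‖ ≤ ρ := fun t ht => (hρ' t ht).trans (le_max_left _ _)
  obtain ⟨s, hs⟩ := exists_gt r
  have hs0 : 0 < s := h.hr.trans hs
  set δ : ℝ := (2 * (ρ + s))⁻¹
  have hδ : 0 < δ := by positivity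
  have hQ := h.differentiableOn_pCInv hs
  obtain ⟨C, hC, hCb⟩ := h.norm_pCInv_le hs
  have hQ' : ContinuousOn (deriv (pCInv a)) (Metric.ball 0 s⁻¹) :=
    (hQ.deriv Metric.isOpen_ball).continuousOn
  have hsub : Metric.closedBall (0 : ℂ) (ρ + s)⁻¹ ⊆ Metric.ball 0 s⁻¹ :=
    Metric.closedBall_subset_ball (inv_strictAnti₀ hs0 (by linarith))
  obtain ⟨B, hB⟩ := (isCompact_closedBall (0 : ℂ) (ρ + s)⁻¹).exists_bound_of_continuousOn
    (hQ'.mono hsub)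
  have hden : ∀ u ∈ Metric.ball (0 : ℂ) δ, ∀ t ∈ K, 1 / 2 ≤ ‖1 - u * z t‖ := by
    intro u hu t ht
    have hu' : ‖u‖ ≤ δ := (mem_ball_zero_iff.1 hu).le
    have h1 : ‖u * z t‖ ≤ δ * ρ := by
      rw [norm_mul]; exact mul_le_mul hu' (hzρ t ht) (norm_nonneg _) hδ.le
    have h2 : δ * ρ ≤ 1 / 2 := by
      rw [inv_mul_le_iff₀ (by positivity)]; linarith
    have h3 := norm_sub_norm_le (1 : ℂ) (u * z t)
    rw [norm_one] at h3
    linarith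
  have hden0 : ∀ u ∈ Metric.ball (0 : ℂ) δ, ∀ t ∈ K, 1 - u * z t ≠ 0 := fun u hu t ht =>
    norm_pos_iff.1 (by linarith [hden u hu t ht])
  have hVn : ∀ u ∈ Metric.ball (0 : ℂ) δ, ∀ t ∈ K, ‖u / (1 - u * z t)‖ ≤ 2 * ‖u‖ := by
    intro u hu t ht
    rw [norm_div, div_le_iff₀ (by linarith [hden u hu t ht])]
    nlinarith [hden u hu t ht, norm_nonneg u]
  have hVm : ∀ u ∈ Metric.ball (0 : ℂ) δ, ∀ t ∈ K,
      u / (1 - u * z t) ∈ Metric.closedBall (0 : ℂ) (ρ + s)⁻¹ := by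
    intro u hu t ht
    rw [mem_closedBall_zero_iff]
    refine (hVn u hu t ht).trans ?_
    have hu' : ‖u‖ ≤ δ := (mem_ball_zero_iff.1 hu).le
    calc 2 * ‖u‖ ≤ 2 * δ := by gcongr
      _ = (ρ + s)⁻¹ := by simp only [δ, mul_inv]; ring
  have hVcont : ∀ u ∈ Metric.ball (0 : ℂ) δ, ContinuousOn (fun t => u / (1 - u * z t)) K :=
    fun u hu => ContinuousOn.div (by fun_prop) (by fun_prop) (hden0 u hu)
  have hFcont : ∀ u ∈ Metric.ball (0 : ℂ) δ,
      ContinuousOn (fun t => w t * pCInv a (u / (1 - u * z t))) K := fun u hu =>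
    hw.mul (hQ.continuousOn.comp (hVcont u hu) fun t ht => hsub (hVm u hu t ht))
  have hF'cont : ∀ u ∈ Metric.ball (0 : ℂ) δ, ContinuousOn (fun t => w t *
      (deriv (pCInv a) (u / (1 - u * z t)) * (1 / (1 - u * z t) ^ 2))) K := fun u hu =>
    hw.mul ((hQ'.comp (hVcont u hu) fun t ht => hsub (hVm u hu t ht)).mul
      (ContinuousOn.div (by fun_prop) (by fun_prop) fun t ht => pow_ne_zero 2 (hden0 u hu t ht)))
  have hKm := hK.measurableSet
  have hKfin : m K ≠ ⊤ := hK.measure_lt_top.ne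
  have hΦ : DifferentiableOn ℂ (fun u => ∫ t in K, w t * pCInv a (u / (1 - u * z t)) ∂m)
      (Metric.ball 0 δ) := by
    intro u₀ hu₀
    have hnhds : Metric.ball (0 : ℂ) δ ∈ 𝓝 u₀ := Metric.isOpen_ball.mem_nhds hu₀
    refine (hasDerivAt_integral_of_dominated_loc_of_deriv_le (bound := fun _ => W * (B * 4))
      (F' := fun u t => w t * (deriv (pCInv a) (u / (1 - u * z t)) * (1 / (1 - u * z t) ^ 2))) hnhds
      (eventually_of_mem hnhds fun u hu => (hFcont u hu).aestronglyMeasurable hKm)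
      ((hFcont u₀ hu₀).integrableOn_compact hK)
      ((hF'cont u₀ hu₀).aestronglyMeasurable hKm) ?_
      (integrableOn_const hKfin) ?_).2.differentiableAt.differentiableWithinAt
    · refine (ae_restrict_iff' hKm).2 (ae_of_all _ fun t ht u hu => ?_)
      have h1 := hB _ (hVm u hu t ht)
      have h2 := hden u hu t ht
      have h3 : ‖1 / (1 - u * z t) ^ 2‖ ≤ 4 := by
        rw [norm_div, norm_pow, norm_one, div_le_iff₀ (by positivity)]
        nlinarith
      rw [norm_mul, norm_mul]
      have hW0 := (norm_nonneg _).trans (hW t ht)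
      have hB0 := (norm_nonneg _).trans h1
      gcongr
      exact hW t ht
    · refine (ae_restrict_iff' hKm).2 (ae_of_all _ fun t ht u hu => ?_)
      have hd : HasDerivAt (fun u => u / (1 - u * z t)) (1 / (1 - u * z t) ^ 2) u := by
        refine ((hasDerivAt_id' u).fun_div (((hasDerivAt_id' u).mul_const (z t)).const_sub 1)
          (hden0 u hu t ht)).congr_deriv ?_
        ring
      exact ((hQ.differentiableAt (Metric.isOpen_ball.mem_nhds
        (hsub (hVm u hu t ht)))).hasDerivAt.comp u hd).const_mul (w t)
  have hΦb : ∀ u ∈ Metric.ball (0 : ℂ) δ,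
      ‖∫ t in K, w t * pCInv a (u / (1 - u * z t)) ∂m‖ ≤ W * (C * 4) * m.real K * ‖u‖ ^ 2 := by
    intro u hu
    have : ∀ t ∈ K, ‖w t * pCInv a (u / (1 - u * z t))‖ ≤ W * (C * 4) * ‖u‖ ^ 2 := by
      intro t ht
      have h1 := hCb _ (mem_ball_zero_iff.1 (hsub (hVm u hu t ht))).le
      have h2 := hVn u hu t ht
      have hW0 := (norm_nonneg _).trans (hW t ht)
      rw [norm_mul]
      calc _ ≤ W * (C * (2 * ‖u‖) ^ 2) := by
            gcongr
            · exact hW t ht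
            · exact h1.trans (by gcongr)
        _ = _ := by ring
    refine (norm_setIntegral_le_of_norm_le_const hK.measure_lt_top this).trans (le_of_eq ?_)
    ring
  obtain ⟨c, σ, hσ, hc0, hc1, hc⟩ := hasExpansionAtInfty_of_differentiableOn hδ hΦ hΦb
  refine ⟨c, σ, hσ, hc0, hc1, fun x hx => ?_⟩
  convert hc x hx using 1
  refine integral_congr_ae (ae_of_all _ fun t => ?_)
  dsimp only
  have hx0 : (x : ℂ) ≠ 0 := by
    rw [Complex.ofReal_ne_zero, ← abs_pos]; exact hσ.trans hx
  rw [pC_eq_pCInv_inv]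
  congr 1
  field_simp

end Expansion

section Contour

/-- The integral of `g` over the three upper sides of the box `[c - R, c + R] × [0, R]`, taken
from left to right. -/
noncomputable def boxDetour (g : ℂ → ℂ) (c R : ℝ) : ℂ :=
  (∫ t in (-R)..R, g (c + t + R * I)) + I * (∫ y in (0 : ℝ)..R, g (c - R + y * I)) -
    I * ∫ y in (0 : ℝ)..R, g (c + R + y * I)

/-- The upper half-plane with the half-open box around `c` removed. -/
def outsideBox (c R : ℝ) : Set ℂ := {z | 0 ≤ z.im ∧ (R ≤ |z.re - c| ∨ R ≤ z.im)}

lemma rectangle_integral_eq_zero {g : ℂ → ℂ} {x₁ x₂ y₁ y₂ : ℝ} (hx : x₁ ≤ x₂) (hy : y₁ ≤ y₂)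
    (hg : ∀ z : ℂ, x₁ ≤ z.re → z.re ≤ x₂ → y₁ ≤ z.im → z.im ≤ y₂ → DifferentiableAt ℂ g z) :
    (∫ x in x₁..x₂, g (x + y₁ * I)) - (∫ x in x₁..x₂, g (x + y₂ * I)) +
      I * (∫ y in y₁..y₂, g (x₂ + y * I)) - I * (∫ y in y₁..y₂, g (x₁ + y * I)) = 0 := by
  have := Complex.integral_boundary_rect_eq_zero_of_differentiableOn g (x₁ + y₁ * I) (x₂ + y₂ * I)
    (fun z hz => by
      simp only [mem_reProdIm, add_re, ofReal_re, mul_re, I_re, mul_zero, ofReal_im, I_im, mul_one,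
        sub_self, add_zero, add_im, mul_im, zero_add, uIcc_of_le hx, uIcc_of_le hy, mem_Icc] at hz
      exact (hg z hz.1.1 hz.1.2 hz.2.1 hz.2.2).differentiableWithinAt)
  simpa using this

lemma intervalIntegrable_of_differentiableAt {g : ℂ → ℂ} {γ : ℝ → ℂ} (hγ : Continuous γ)
    {a b : ℝ} (hab : a ≤ b) (hg : ∀ t, a ≤ t → t ≤ b → DifferentiableAt ℂ g (γ t)) :
    IntervalIntegrable (fun t => g (γ t)) volume a b := by
  refine ContinuousOn.intervalIntegrable fun t ht => ?_
  rw [uIcc_of_le hab] at ht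
  exact ((hg t ht.1 ht.2).continuousAt.comp hγ.continuousAt).continuousWithinAt

/-- Over a real segment containing a deleted interval, integrating `g` off the interval and
detouring over the box gives the integral along the other three sides of a tall rectangle. -/
lemma integral_add_boxDetour {g : ℂ → ℂ} {c R x₁ x₂ T : ℝ} (hR : 0 < R) (hRT : R ≤ T)
    (h₁ : x₁ ≤ c - R) (h₂ : c + R ≤ x₂)
    (hg : ∀ z ∈ outsideBox c R, x₁ ≤ z.re → z.re ≤ x₂ → DifferentiableAt ℂ g z) :
    (∫ x in x₁..(c - R), g x) + (∫ x in (c + R)..x₂, g x) + boxDetour g c R =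
      (∫ x in x₁..x₂, g (x + T * I)) - I * (∫ y in (0 : ℝ)..T, g (x₂ + y * I)) +
        I * ∫ y in (0 : ℝ)..T, g (x₁ + y * I) := by
  have hout : ∀ z : ℂ, 0 ≤ z.im → z.re ≤ c - R ∨ c + R ≤ z.re ∨ R ≤ z.im → z ∈ outsideBox c R := by
    rintro z hz (h | h | h)
    · exact ⟨hz, Or.inl (by rw [le_abs]; right; linarith)⟩
    · exact ⟨hz, Or.inl (by rw [le_abs]; left; linarith)⟩
    · exact ⟨hz, Or.inr h⟩
  have hL := rectangle_integral_eq_zero (g := g) h₁ (hR.le.trans hRT) fun z a1 a2 a3 a4 =>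
    hg z (hout z a3 (Or.inl a2)) a1 (by linarith)
  have hM := rectangle_integral_eq_zero (g := g) (x₁ := c - R) (x₂ := c + R) (by linarith) hRT
    fun z a1 a2 a3 a4 =>
    hg z (hout z (hR.le.trans a3) (Or.inr (Or.inr a3))) (by linarith) (by linarith)
  have hN := rectangle_integral_eq_zero (g := g) h₂ (hR.le.trans hRT) fun z a1 a2 a3 a4 =>
    hg z (hout z a3 (Or.inr (Or.inl a1))) (by linarith) a2
  have htop : ∀ u v : ℝ, u ≤ v → x₁ ≤ u → v ≤ x₂ →
      IntervalIntegrable (fun x : ℝ => g (x + T * I)) volume u v := fun u v huv hu hv =>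
    intervalIntegrable_of_differentiableAt (by fun_prop) huv fun t ht1 ht2 =>
      hg _ (hout _ (by simpa using hR.le.trans hRT) (Or.inr (Or.inr (by simpa using hRT))))
        (by simpa using hu.trans ht1) (by simpa using ht2.trans hv)
  have hside : ∀ u v e : ℝ, u ≤ v → 0 ≤ u → (e = c - R ∨ e = c + R) →
      IntervalIntegrable (fun y : ℝ => g (e + y * I)) volume u v := by
    intro u v e huv hu he
    refine intervalIntegrable_of_differentiableAt (by fun_prop) huv fun t ht1 ht2 =>
      hg _ (hout _ (by simpa using hu.trans ht1) ?_) ?_ ?_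
    · rcases he with rfl | rfl
      · left; simp
      · right; left; simp
    · rcases he with rfl | rfl
      · simpa using h₁
      · simp; linarith
    · rcases he with rfl | rfl
      · simp; linarith
      · simpa using h₂
  have e1 := intervalIntegral.integral_add_adjacent_intervals
    (htop x₁ (c - R) h₁ le_rfl (by linarith)) (htop (c - R) x₂ (by linarith) h₁ le_rfl)
  have e2 := intervalIntegral.integral_add_adjacent_intervals
    (htop (c - R) (c + R) (by linarith) h₁ h₂) (htop (c + R) x₂ h₂ (by linarith) le_rfl)
  have e3 := intervalIntegral.integral_add_adjacent_intervals
    (hside 0 R (c - R) hR.le le_rfl (Or.inl rfl)) (hside R T (c - R) hRT hR.le (Or.inl rfl))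
  have e4 := intervalIntegral.integral_add_adjacent_intervals
    (hside 0 R (c + R) hR.le le_rfl (Or.inr rfl)) (hside R T (c + R) hRT hR.le (Or.inr rfl))
  have e5 : (∫ t in (-R)..R, g (c + t + R * I)) = ∫ x in (c - R)..(c + R), g (x + R * I) := by
    rw [sub_eq_add_neg, ← intervalIntegral.integral_comp_add_left]
    simp
  simp only [ofReal_zero, zero_mul, add_zero, ofReal_sub, ofReal_add] at hL hM hN e3 e4
  rw [boxDetour, e5]
  linear_combination hL + hM + hN + e1 + e2 + I * e3 - I * e4

lemma intervalIntegral_eq_zero_of_Ioo {f : ℝ → ℂ} {a b : ℝ} (hab : a ≤ b)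
    (hf : ∀ t, a < t → t < b → f t = 0) : ∫ t in a..b, f t = 0 := by
  rw [intervalIntegral.integral_of_le hab, integral_Ioc_eq_integral_Ioo]
  exact setIntegral_eq_zero_of_forall_eq_zero fun t ht => hf t ht.1 ht.2

lemma integral_eq_neg_boxDetour_of_le {g : ℂ → ℂ} {α β R M C : ℝ} (hR : 0 < R)
    (hαβ : α + R ≤ β - R)
    (hg : ∀ z ∈ outsideBox α R ∩ outsideBox β R, DifferentiableAt ℂ g z)
    (hC : ∀ z : ℂ, M ≤ ‖z‖ → ‖g z‖ ≤ C / ‖z‖ ^ 2)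
    (hint : Integrable ({t : ℝ | R ≤ |t - α| ∧ R ≤ |t - β|}.indicator fun t => g t)) :
    ∫ t, {t : ℝ | R ≤ |t - α| ∧ R ≤ |t - β|}.indicator (fun t : ℝ => g t) t =
      -(boxDetour g α R + boxDetour g β R) := by
  set S := {t : ℝ | R ≤ |t - α| ∧ R ≤ |t - β|}
  set G := S.indicator fun t : ℝ => g t
  set P : ℝ → ℂ := fun T => (∫ x in (-T)..T, g (x + T * I)) -
    I * (∫ y in (0 : ℝ)..T, g (T + y * I)) + I * ∫ y in (0 : ℝ)..T, g ((-T : ℝ) + y * I)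
  have hlim : Tendsto (fun T => ∫ t in (-T)..T, G t) atTop (𝓝 (∫ t, G t)) :=
    intervalIntegral_tendsto_integral hint tendsto_neg_atTop_atBot tendsto_id
  have hlarge : ∀ᶠ T in atTop, M ≤ T ∧ R ≤ T ∧ -T ≤ α - R ∧ β + R ≤ T ∧ 0 < T := by
    filter_upwards [eventually_ge_atTop M, eventually_ge_atTop R, eventually_ge_atTop (R - α),
      eventually_ge_atTop (β + R), eventually_gt_atTop 0] with T h1 h2 h3 h4 h5
    exact ⟨h1, h2, by linarith, h4, h5⟩
  have heq : ∀ᶠ T in atTop, ∫ t in (-T)..T, G t = P T - (boxDetour g α R + boxDetour g β R) := by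
    filter_upwards [hlarge] with T ⟨hM, hRT, hα, hβ, hT⟩
    set m := (α + β) / 2 with hm
    have hmem : ∀ z : ℂ, ∀ c c' : ℝ, z ∈ outsideBox c R → R ≤ |z.re - c'| → z ∈ outsideBox c' R :=
      fun z c c' hz hc => ⟨hz.1, Or.inl hc⟩
    have hl := integral_add_boxDetour (g := g) (x₁ := -T) (x₂ := m) hR hRT hα (by linarith)
      fun z hz h1 h2 => hg z ⟨hz, hmem z _ _ hz (by rw [le_abs]; right; linarith)⟩
    have hr := integral_add_boxDetour (g := g) (x₁ := m) (x₂ := T) hR hRT (by linarith) hβ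
      fun z hz h1 h2 => hg z ⟨hmem z _ _ hz (by rw [le_abs]; left; linarith), hz⟩
    have hGi : ∀ u v, IntervalIntegrable G volume u v := fun u v => hint.intervalIntegrable
    have hGe : ∀ u v : ℝ, u ≤ v → (∀ t, u ≤ t → t ≤ v → t ∈ S) →
        ∫ t in u..v, G t = ∫ t in u..v, g t := by
      intro u v huv h
      refine intervalIntegral.integral_congr fun t ht => ?_
      rw [uIcc_of_le huv] at ht
      exact indicator_of_mem (h t ht.1 ht.2) _
    have k1 := hGe (-T) (α - R) hα fun t h1 h2 =>
      ⟨by rw [le_abs]; right; linarith, by rw [le_abs]; right; linarith⟩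
    have k2 : ∫ t in (α - R)..(α + R), G t = 0 :=
      intervalIntegral_eq_zero_of_Ioo (by linarith) fun t h1 h2 => indicator_of_notMem (fun h => by
        have := h.1
        rw [le_abs] at this
        rcases this with h | h <;> linarith) _
    have k3 := hGe (α + R) m (by linarith) fun t h1 h2 =>
      ⟨by rw [le_abs]; left; linarith, by rw [le_abs]; right; linarith⟩
    have k4 := hGe m (β - R) (by linarith) fun t h1 h2 =>
      ⟨by rw [le_abs]; left; linarith, by rw [le_abs]; right; linarith⟩
    have k5 : ∫ t in (β - R)..(β + R), G t = 0 :=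
      intervalIntegral_eq_zero_of_Ioo (by linarith) fun t h1 h2 => indicator_of_notMem (fun h => by
        have := h.2
        rw [le_abs] at this
        rcases this with h | h <;> linarith) _
    have k6 := hGe (β + R) T hβ fun t h1 h2 =>
      ⟨by rw [le_abs]; left; linarith, by rw [le_abs]; left; linarith⟩
    have hmid : ∀ u v : ℝ, -T ≤ u → u ≤ v → v ≤ T →
        IntervalIntegrable (fun x : ℝ => g (x + T * I)) volume u v := fun u v hu huv hv =>
      intervalIntegrable_of_differentiableAt (by fun_prop) huv fun t ht1 ht2 =>
        hg _ ⟨⟨by simpa using hT.le, Or.inr (by simpa using hRT)⟩,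
          ⟨by simpa using hT.le, Or.inr (by simpa using hRT)⟩⟩
    have htop := intervalIntegral.integral_add_adjacent_intervals
      (hmid (-T) m le_rfl (by linarith) (by linarith))
      (hmid m T (by linarith) (by linarith) le_rfl)
    have s1 := intervalIntegral.integral_add_adjacent_intervals (hGi (-T) (α - R)) (hGi (α - R) T)
    have s2 := intervalIntegral.integral_add_adjacent_intervals (hGi (α - R) (α + R)) (hGi (α + R) T)
    have s3 := intervalIntegral.integral_add_adjacent_intervals (hGi (α + R) m) (hGi m T)
    have s4 := intervalIntegral.integral_add_adjacent_intervals (hGi m (β - R)) (hGi (β - R) T)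
    have s5 := intervalIntegral.integral_add_adjacent_intervals (hGi (β - R) (β + R)) (hGi (β + R) T)
    simp only [P]
    linear_combination hl + hr + htop - s1 - s2 - s3 - s4 - s5 + k1 + k2 + k3 + k4 + k5 + k6
  have hP : Tendsto P atTop (𝓝 0) := by
    have h0 : Tendsto (fun T : ℝ => 4 * C / T) atTop (𝓝 0) := tendsto_const_nhds.div_atTop tendsto_id
    refine squeeze_zero_norm' ?_ h0
    filter_upwards [hlarge] with T ⟨hM, hRT, hα, hβ, hT⟩
    have hC' : ∀ z : ℂ, T ≤ ‖z‖ → ‖g z‖ ≤ C / T ^ 2 := by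
      intro z hz
      have h1 := hC z (hM.trans hz)
      have hz0 : 0 < ‖z‖ := hT.trans_le hz
      have hC0 : 0 ≤ C := by
        by_contra! hneg
        exact absurd ((norm_nonneg _).trans h1) (not_le.2 (div_neg_of_neg_of_pos hneg (by positivity)))
      exact h1.trans (by gcongr)
    have b1 : ‖∫ x in (-T)..T, g (x + T * I)‖ ≤ C / T ^ 2 * |T - -T| :=
      intervalIntegral.norm_integral_le_of_norm_le_const fun x _ => hC' _ <| by
        simpa [abs_of_pos hT] using abs_im_le_norm ((x : ℂ) + T * I)
    have b2 : ∀ e : ℝ, |e| = T → ‖I * ∫ y in (0 : ℝ)..T, g (e + y * I)‖ ≤ C / T ^ 2 * |T - 0| := by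
      intro e he
      rw [norm_mul, norm_I, one_mul]
      exact intervalIntegral.norm_integral_le_of_norm_le_const fun y _ => hC' _ <| by
        simpa [he] using abs_re_le_norm ((e : ℂ) + y * I)
    refine (norm_add_le _ _).trans ((add_le_add_left (norm_sub_le _ _) _).trans ?_)
    have b3 := b2 T (abs_of_pos hT)
    have b4 := b2 (-T) (by rw [abs_neg, abs_of_pos hT])
    rw [abs_of_pos (by linarith)] at b1 b3 b4
    calc _ ≤ C / T ^ 2 * (T - -T) + C / T ^ 2 * (T - 0) + C / T ^ 2 * (T - 0) := by gcongr
      _ = _ := by field_simp; ring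
  have := tendsto_nhds_unique hlim ((hP.sub_const _).congr' (heq.mono fun T h => h.symm))
  rw [this, zero_sub]

/-- Closing the contour in the upper half-plane: the integral of `g` over the real line with
intervals around `α` and `β` deleted is minus the sum of the two detours. -/
lemma integral_eq_neg_boxDetour {g : ℂ → ℂ} {α β R M C : ℝ} (hR : 0 < R)
    (hαβ : 2 * R ≤ |α - β|)
    (hg : ∀ z ∈ outsideBox α R ∩ outsideBox β R, DifferentiableAt ℂ g z)
    (hC : ∀ z : ℂ, M ≤ ‖z‖ → ‖g z‖ ≤ C / ‖z‖ ^ 2)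
    (hint : Integrable ({t : ℝ | R ≤ |t - α| ∧ R ≤ |t - β|}.indicator fun t => g t)) :
    ∫ t, {t : ℝ | R ≤ |t - α| ∧ R ≤ |t - β|}.indicator (fun t : ℝ => g t) t =
      -(boxDetour g α R + boxDetour g β R) := by
  rcases le_abs.1 hαβ with h | h
  · have hS : {t : ℝ | R ≤ |t - α| ∧ R ≤ |t - β|} = {t : ℝ | R ≤ |t - β| ∧ R ≤ |t - α|} :=
      ext fun t => and_comm
    rw [hS] at hint ⊢
    rw [add_comm]
    exact integral_eq_neg_boxDetour_of_le hR (by linarith) (by rwa [inter_comm]) hC hint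
  · exact integral_eq_neg_boxDetour_of_le hR (by linarith) hg hC hint

end Contour

section Density

variable {p : ℝ → ℝ} {a : ℕ → ℝ} {r R : ℝ}

lemma HasExpansionAtInfty.congr {f g : ℝ → ℂ} (hf : HasExpansionAtInfty f) (σ : ℝ)
    (h : ∀ x : ℝ, σ < |x| → g x = f x) : HasExpansionAtInfty g := by
  obtain ⟨c, ρ, hρ, hc0, hc1, hc⟩ := hf
  refine ⟨c, max ρ σ, by positivity, hc0, hc1, fun x hx => ?_⟩
  rw [h x ((le_max_right _ _).trans_lt hx)]
  exact hc x ((le_max_left _ _).trans_lt hx)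

/-- The density of `tailMeasure p R`. -/
noncomputable def tailDensity (p : ℝ → ℝ) (R x : ℝ) : ℝ := if R ≤ |x| then p x else 0

lemma tailMeasure_eq (p : ℝ → ℝ) (R : ℝ) :
    tailMeasure p R = volume.withDensity fun x => ENNReal.ofReal (tailDensity p R x) := rfl

lemma A2.mono (h : A2 p a r R) {R' : ℝ} (hR : R ≤ R') : A2 p a r R' :=
  { h with hrR := h.hrR.trans_le hR, hpos := fun x hx => h.hpos x (hR.trans hx) }

lemma A2.tailDensity_nonneg (h : A2 p a r R) (x : ℝ) : 0 ≤ tailDensity p R x := by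
  unfold tailDensity
  split_ifs with hx
  exacts [h.hpos x hx, le_rfl]

lemma measurableSet_le_abs (R : ℝ) : MeasurableSet {x : ℝ | R ≤ |x|} :=
  measurableSet_le measurable_const continuous_abs.measurable

lemma A2.measurable_tailDensity (h : A2 p a r R) : Measurable (tailDensity p R) := by
  refine measurable_of_tendsto_metrizable
    (f := fun N x => if R ≤ |x| then ∑ n ∈ Finset.range N, a n / x ^ n else 0)
    (fun N => Measurable.ite (measurableSet_le_abs R) (by fun_prop) measurable_const) ?_
  refine tendsto_pi_nhds.2 fun x => ?_
  unfold tailDensity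
  split_ifs with hx
  · exact (h.hsum x (h.hrR.trans_le hx)).tendsto_sum_nat
  · exact tendsto_const_nhds

lemma A2.tailDensity_le (h : A2 p a r R) :
    ∃ C, ∀ x, tailDensity p R x ≤ C * (1 + x ^ 2)⁻¹ := by
  obtain ⟨C, hC, hb⟩ := h.norm_pC_le
  have hR : 0 < R := h.hr.trans h.hrR
  refine ⟨C * ((1 + R ^ 2) / R ^ 2), fun x => ?_⟩
  unfold tailDensity
  split_ifs with hx
  · have h1 := hb x (by simpa using hx)
    rw [h.pC_ofReal (h.hrR.trans_le hx), Complex.norm_real, Complex.norm_real, Real.norm_eq_abs,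
      Real.norm_eq_abs, sq_abs] at h1
    have hx2 : R ^ 2 ≤ x ^ 2 := by rw [← sq_abs x]; gcongr
    have hx0 : 0 < x ^ 2 := lt_of_lt_of_le (by positivity) hx2
    refine (le_abs_self _).trans (h1.trans ?_)
    rw [mul_assoc, div_eq_mul_inv]
    gcongr
    rw [← div_eq_mul_inv, inv_eq_one_div, div_div, div_le_div_iff₀ hx0 (by positivity)]
    nlinarith
  · positivity

lemma A2.integrable_tailDensity (h : A2 p a r R) : Integrable (tailDensity p R) := by
  obtain ⟨C, hC⟩ := h.tailDensity_le
  refine (integrable_inv_one_add_sq.const_mul C).mono' h.measurable_tailDensity.aestronglyMeasurable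
    (ae_of_all _ fun x => ?_)
  rw [Real.norm_of_nonneg (h.tailDensity_nonneg x)]
  exact hC x

lemma A2.exists_norm_tailDensity_le (h : A2 p a r R) : ∃ C, ∀ x, ‖tailDensity p R x‖ ≤ C := by
  obtain ⟨C, hC⟩ := h.tailDensity_le
  have hC0 : 0 ≤ C := by simpa using (h.tailDensity_nonneg 0).trans (hC 0)
  refine ⟨C, fun x => ?_⟩
  rw [Real.norm_of_nonneg (h.tailDensity_nonneg x)]
  refine (hC x).trans (mul_le_of_le_one_right hC0 (inv_le_one_of_one_le₀ ?_))
  nlinarith [sq_nonneg x]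

/-- `D` is a measurable density which near infinity is real, nonnegative and given by a
series `∑ cₙ / xⁿ` with `c₀ = c₁ = 0`. -/
def HasAnalyticTail (D : ℝ → ENNReal) : Prop :=
  Measurable D ∧ ∃ d : ℝ → ℝ, HasExpansionAtInfty (fun x => (d x : ℂ)) ∧ (∀ x, 0 ≤ d x) ∧
    ∃ ρ, ∀ x : ℝ, ρ < |x| → D x = ENNReal.ofReal (d x)

lemma HasAnalyticTail.add {D E : ℝ → ENNReal} (hD : HasAnalyticTail D) (hE : HasAnalyticTail E) :
    HasAnalyticTail (D + E) := by
  obtain ⟨hDm, d, hd, hd0, ρ, hρ⟩ := hD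
  obtain ⟨hEm, e, he, he0, σ, hσ⟩ := hE
  refine ⟨hDm.add hEm, fun x => d x + e x, by simpa using hd.add he,
    fun x => add_nonneg (hd0 x) (he0 x), max ρ σ, fun x hx => ?_⟩
  rw [Pi.add_apply, hρ x ((le_max_left _ _).trans_lt hx), hσ x ((le_max_right _ _).trans_lt hx),
    ENNReal.ofReal_add (hd0 x) (he0 x)]

lemma withDensity_eq_add_indicator {D : ℝ → ENNReal} (hD : Measurable D) (R : ℝ) :
    volume.withDensity D = volume.withDensity ({x : ℝ | R ≤ |x|}ᶜ.indicator D) +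
      volume.withDensity ({x : ℝ | R ≤ |x|}.indicator D) := by
  rw [← withDensity_add_left (hD.indicator (measurableSet_le_abs R).compl), add_comm,
    indicator_self_add_compl]

lemma withDensity_indicator_compl_Icc (D : ℝ → ENNReal) (R : ℝ) :
    volume.withDensity ({x : ℝ | R ≤ |x|}ᶜ.indicator D) (Icc (-R) R)ᶜ = 0 := by
  rw [withDensity_apply _ measurableSet_Icc.compl]
  refine setLIntegral_eq_zero measurableSet_Icc.compl fun x hx => indicator_of_notMem ?_ _
  rw [notMem_compl_iff, mem_ofPred_eq]
  by_contra! h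
  exact hx ⟨(abs_lt.1 h).1.le, (abs_lt.1 h).2.le⟩

lemma HasAnalyticTail.memP1 {D : ℝ → ENNReal} (hD : HasAnalyticTail D) {ν : Measure ℝ} {K : Set ℝ}
    (hK : IsCompact K) (hν : ν Kᶜ = 0) : memP1 (ν + volume.withDensity D) := by
  obtain ⟨hDm, d, ⟨c, ρ, hρ, hc0, hc1, hc⟩, hd0, σ, hσ⟩ := hD
  set r := max ρ σ
  have hr : 0 < r := by positivity
  have hsum : ∀ x : ℝ, r < |x| → HasSum (fun n => (c n).re / x ^ n) (d x) := fun x hx => by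
    simpa only [← ofReal_pow, div_ofReal_re, ofReal_re] using
      Complex.hasSum_re (hc x ((le_max_left _ _).trans_lt hx))
  refine ⟨ν + volume.withDensity ({x : ℝ | r + 1 ≤ |x|}ᶜ.indicator D), d, fun n => (c n).re, r,
    r + 1, ⟨hr, by linarith, by simp [hc0], by simp [hc1], hsum, fun x hx => ?_, fun x _ => hd0 x⟩,
    ⟨K ∪ Icc (-(r + 1)) (r + 1), hK.union isCompact_Icc, ?_⟩, ?_⟩
  · simpa only [abs_div, abs_pow] using (hsum x hx).summable.abs
  · rw [Measure.add_apply, add_eq_zero]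
    exact ⟨measure_mono_null (compl_subset_compl.2 subset_union_left) hν, measure_mono_null
      (compl_subset_compl.2 subset_union_right) (withDensity_indicator_compl_Icc D (r + 1))⟩
  · rw [withDensity_eq_add_indicator hDm (r + 1), ← add_assoc, tailMeasure]
    congr 2
    ext x
    by_cases hx : r + 1 ≤ |x|
    · rw [indicator_of_mem (show x ∈ {x : ℝ | r + 1 ≤ |x|} from hx), if_pos hx,
        hσ x ((le_max_right ρ σ).trans_lt (by linarith))]
    · rw [indicator_of_notMem (show x ∉ {x : ℝ | r + 1 ≤ |x|} from hx), if_neg hx,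
        ENNReal.ofReal_zero]

lemma memP1.exists_decomposition {μ : Measure ℝ} (h : memP1 μ) :
    ∃ (p : ℝ → ℝ) (a : ℕ → ℝ) (r R₀ : ℝ), ∀ R, R₀ ≤ R → A2 p a r R ∧
      ∃ ν : Measure ℝ, ν (Icc (-R) R)ᶜ = 0 ∧ μ = ν + tailMeasure p R := by
  obtain ⟨ν, p, a, r, R₁, hA, ⟨K, hK, hν⟩, rfl⟩ := h
  obtain ⟨B, hB⟩ := hK.isBounded.exists_norm_le
  refine ⟨p, a, r, max R₁ B, fun R hR => ⟨hA.mono ((le_max_left _ _).trans hR),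
    ν + volume.withDensity ({x : ℝ | R ≤ |x|}ᶜ.indicator
      fun x => ENNReal.ofReal (tailDensity p R₁ x)), ?_, ?_⟩⟩
  · rw [Measure.add_apply, add_eq_zero]
    refine ⟨measure_mono_null (compl_subset_compl.2 fun x hx => ?_) hν,
      withDensity_indicator_compl_Icc _ R⟩
    exact abs_le.1 ((hB x hx).trans ((le_max_right _ _).trans hR))
  · rw [add_assoc, tailMeasure_eq p R₁,
      withDensity_eq_add_indicator hA.measurable_tailDensity.ennreal_ofReal R, tailMeasure_eq p R]
    congr 3
    ext x
    by_cases hx : R ≤ |x|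
    · rw [indicator_of_mem (show x ∈ {x : ℝ | R ≤ |x|} from hx), tailDensity, tailDensity,
        if_pos hx, if_pos ((le_max_left _ _).trans (hR.trans hx))]
    · rw [indicator_of_notMem (show x ∉ {x : ℝ | R ≤ |x|} from hx), tailDensity, if_neg hx,
        ENNReal.ofReal_zero]

lemma conv_withDensity (ν : Measure ℝ) [SFinite ν] {k : ℝ → ENNReal} (hk : Measurable k) :
    ν.conv (volume.withDensity k) = volume.withDensity fun x => ∫⁻ t, k (x - t) ∂ν := by
  refine Measure.ext_of_lintegral _ fun f hf => ?_
  have hm : Measurable fun x => ∫⁻ t, k (x - t) ∂ν := by fun_prop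
  rw [Measure.lintegral_conv hf, lintegral_withDensity_eq_lintegral_mul _ hm hf]
  simp only [Pi.mul_apply]
  calc ∫⁻ t, ∫⁻ y, f (t + y) ∂volume.withDensity k ∂ν
      = ∫⁻ t, ∫⁻ x, k (x - t) * f x ∂volume ∂ν := by
        refine lintegral_congr fun t => ?_
        rw [lintegral_withDensity_eq_lintegral_mul _ hk (by fun_prop),
          ← lintegral_sub_right_eq_self _ t]
        simp
    _ = ∫⁻ x, ∫⁻ t, k (x - t) * f x ∂ν ∂volume := lintegral_lintegral_swap (by fun_prop)
    _ = _ := lintegral_congr fun x => lintegral_mul_const _ (by fun_prop)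

/-- The convolution of a finite compactly supported measure with a tail has an analytic tail. -/
lemma A2.hasAnalyticTail_compact (h : A2 p a r R) (ν : Measure ℝ) [IsFiniteMeasure ν]
    (hν : ν (Icc (-R) R)ᶜ = 0) :
    HasAnalyticTail fun x => ∫⁻ t, ENNReal.ofReal (tailDensity p R (x - t)) ∂ν := by
  have hkm := h.measurable_tailDensity
  obtain ⟨C, hC⟩ := h.exists_norm_tailDensity_le
  refine ⟨by fun_prop, fun x => ∫ t, tailDensity p R (x - t) ∂ν, ?_,
    fun x => integral_nonneg fun t => h.tailDensity_nonneg _, 0, fun x _ => ?_⟩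
  · refine (h.hasExpansionAtInfty_integral ν isCompact_Icc (K := Icc (-R) R) (z := fun t => t)
      (w := fun _ => 1) (by fun_prop) (by fun_prop)).congr (2 * R) fun x hx => ?_
    have hres : ν.restrict (Icc (-R) R) = ν := Measure.restrict_eq_self_of_ae_mem hν
    dsimp only
    rw [← integral_complex_ofReal]
    nth_rw 1 [← hres]
    refine setIntegral_congr_fun measurableSet_Icc fun t ht => ?_
    have hxt : R ≤ |x - t| := by
      have := abs_sub_abs_le_abs_sub x t
      have := abs_le.2 ht
      linarith
    rw [tailDensity, if_pos hxt, one_mul, ← ofReal_sub, h.pC_ofReal (h.hrR.trans_le hxt)]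
  · rw [ofReal_integral_eq_lintegral_ofReal _ (ae_of_all _ fun t => h.tailDensity_nonneg _)]
    exact Integrable.of_bound (by fun_prop : Measurable _).aestronglyMeasurable C
      (ae_of_all _ fun t => hC _)

lemma A2.hasExpansionAtInfty_intervalIntegral {p q : ℝ → ℝ} {a b : ℕ → ℝ} {r s R S : ℝ}
    (hp : A2 p a r R) (hq : A2 q b s S) {z : ℝ → ℂ} (hz : Continuous z) {u v : ℝ} (huv : u ≤ v)
    (hzr : ∀ t ∈ Icc u v, R ≤ ‖z t‖) :
    HasExpansionAtInfty fun x => ∫ t in u..v, pC a (z t) * pC b (x - z t) := by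
  have := hq.hasExpansionAtInfty_integral volume (isCompact_Icc (a := u) (b := v)) hz.continuousOn
    (w := fun t => pC a (z t)) fun t ht => ((hp.differentiableAt_pC
      (hp.hrR.trans_le (hzr t ht))).continuousAt.comp hz.continuousAt).continuousWithinAt
  simpa only [intervalIntegral.integral_of_le huv, integral_Icc_eq_integral_Ioc] using this

lemma A2.hasExpansionAtInfty_boxDetour_zero {p q : ℝ → ℝ} {a b : ℕ → ℝ} {r s R : ℝ}
    (hp : A2 p a r R) (hq : A2 q b s R) :
    HasExpansionAtInfty fun x => boxDetour (fun z => pC a z * pC b (x - z)) 0 R := by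
  have hR : 0 < R := hp.hr.trans hp.hrR
  have h1 := hp.hasExpansionAtInfty_intervalIntegral hq (z := fun t => (0 : ℝ) + t + R * I)
    (by fun_prop) (by linarith : -R ≤ R) fun t _ => by
      simpa [abs_of_pos hR] using abs_im_le_norm ((0 : ℝ) + t + R * I)
  have h2 := hp.hasExpansionAtInfty_intervalIntegral hq (z := fun t => (0 : ℝ) - R + t * I)
    (by fun_prop) hR.le fun t _ => by
      simpa [abs_of_pos hR] using abs_re_le_norm ((0 : ℝ) - R + t * I)
  have h3 := hp.hasExpansionAtInfty_intervalIntegral hq (z := fun t => (0 : ℝ) + R + t * I)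
    (by fun_prop) hR.le fun t _ => by
      simpa [abs_of_pos hR] using abs_re_le_norm ((0 : ℝ) + R + t * I)
  refine ((h1.add (h2.const_mul I)).add (h3.const_mul (-I))).congr 0 fun x _ => ?_
  simp only [boxDetour]
  ring

lemma A2.hasExpansionAtInfty_boxDetour_self {p q : ℝ → ℝ} {a b : ℕ → ℝ} {r s R : ℝ}
    (hp : A2 p a r R) (hq : A2 q b s R) :
    HasExpansionAtInfty fun x => boxDetour (fun z => pC a z * pC b (x - z)) x R := by
  have hR : 0 < R := hp.hr.trans hp.hrR
  have h1 := hq.hasExpansionAtInfty_intervalIntegral hp (z := fun t => -t - R * I)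
    (by fun_prop) (by linarith : -R ≤ R) fun t _ => by
      simpa [abs_of_pos hR] using abs_im_le_norm (-t - R * I)
  have h2 := hq.hasExpansionAtInfty_intervalIntegral hp (z := fun t => R - t * I)
    (by fun_prop) hR.le fun t _ => by
      simpa [abs_of_pos hR] using abs_re_le_norm (R - t * I)
  have h3 := hq.hasExpansionAtInfty_intervalIntegral hp (z := fun t => -R - t * I)
    (by fun_prop) hR.le fun t _ => by
      simpa [abs_of_pos hR] using abs_re_le_norm (-R - t * I)
  refine ((h1.add (h2.const_mul I)).add (h3.const_mul (-I))).congr 0 fun x _ => ?_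
  have hsub : ∀ z w : ℂ, x - z = w → pC a z * pC b (x - z) = pC b w * pC a (x - w) := by
    rintro z w rfl
    rw [sub_sub_cancel, mul_comm]
  have e1 : ∀ t : ℝ, (x : ℂ) - (x + t + R * I) = -t - R * I := fun t => by ring
  have e2 : ∀ t : ℝ, (x : ℂ) - (x - R + t * I) = R - t * I := fun t => by ring
  have e3 : ∀ t : ℝ, (x : ℂ) - (x + R + t * I) = -R - t * I := fun t => by ring
  simp only [boxDetour, fun t => hsub _ _ (e1 t), fun t => hsub _ _ (e2 t),
    fun t => hsub _ _ (e3 t)]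
  ring

/-- The convolution of two tails has an analytic tail. -/
lemma A2.hasAnalyticTail_tailMeasure {p q : ℝ → ℝ} {a b : ℕ → ℝ} {r s R : ℝ}
    (hp : A2 p a r R) (hq : A2 q b s R) :
    HasAnalyticTail fun x =>
      ∫⁻ t, ENNReal.ofReal (tailDensity q R (x - t)) ∂(tailMeasure p R) := by
  have hR : 0 < R := hp.hr.trans hp.hrR
  have hpm := hp.measurable_tailDensity
  have hqm := hq.measurable_tailDensity
  obtain ⟨B, hB⟩ := hq.exists_norm_tailDensity_le
  have hint : ∀ x, Integrable fun t => tailDensity p R t * tailDensity q R (x - t) := fun x =>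
    hp.integrable_tailDensity.mul_bdd (c := B)
      (by fun_prop : Measurable _).aestronglyMeasurable (ae_of_all _ fun t => hB _)
  have hnn : ∀ x t, 0 ≤ tailDensity p R t * tailDensity q R (x - t) := fun x t =>
    mul_nonneg (hp.tailDensity_nonneg _) (hq.tailDensity_nonneg _)
  have : SFinite (tailMeasure p R) := by rw [tailMeasure_eq]; infer_instance
  refine ⟨by fun_prop, fun x => ∫ t, tailDensity p R t * tailDensity q R (x - t), ?_,
    fun x => integral_nonneg fun t => hnn x t, 0, fun x _ => ?_⟩
  · refine (((hp.hasExpansionAtInfty_boxDetour_zero hq).add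
      (hp.hasExpansionAtInfty_boxDetour_self hq)).const_mul (-1)).congr (2 * R) fun x hx => ?_
    obtain ⟨C₁, hC₁, hb₁⟩ := hp.norm_pC_le
    obtain ⟨C₂, hC₂, hb₂⟩ := hq.norm_pC_le
    have hind : (fun t : ℝ => ((tailDensity p R t * tailDensity q R (x - t) : ℝ) : ℂ)) =
        {t : ℝ | R ≤ |t - 0| ∧ R ≤ |t - x|}.indicator
          fun t : ℝ => pC a t * pC b ((x : ℂ) - t) := by
      ext t
      rw [indicator_apply]
      simp only [mem_ofPred_eq, sub_zero, abs_sub_comm t x, tailDensity]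
      by_cases h1 : R ≤ |t| <;> by_cases h2 : R ≤ |x - t| <;> simp only [h1, h2, if_true, if_false,
        and_true, and_false, mul_zero, zero_mul, ofReal_zero]
      rw [← ofReal_sub, hp.pC_ofReal (hp.hrR.trans_le h1), hq.pC_ofReal (hq.hrR.trans_le h2),
        ofReal_mul]
    have key := integral_eq_neg_boxDetour (g := fun z => pC a z * pC b (x - z)) (α := 0) (β := x)
      (M := |x| + R) (C := C₁ * (C₂ / R ^ 2)) hR (by simpa using hx.le) ?_ ?_ ?_
    · dsimp only
      rw [← integral_complex_ofReal]
      exact (congrArg (fun F : ℝ → ℂ => ∫ t, F t) hind).trans (by rw [key]; ring)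
    · rintro z ⟨hz0, hzx⟩
      have n1 : R ≤ ‖z‖ := by
        rcases hz0.2 with h | h
        · rw [sub_zero] at h; exact h.trans (abs_re_le_norm z)
        · exact h.trans ((le_abs_self _).trans (abs_im_le_norm z))
      have n2 : R ≤ ‖(x : ℂ) - z‖ := by
        rw [norm_sub_rev]
        rcases hzx.2 with h | h
        · simpa using h.trans (abs_re_le_norm (z - x))
        · have := (le_abs_self _).trans (abs_im_le_norm (z - x))
          simp only [sub_im, ofReal_im, sub_zero] at this
          exact h.trans this
      exact (hp.differentiableAt_pC (hp.hrR.trans_le n1)).mul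
        ((hq.differentiableAt_pC (hq.hrR.trans_le n2)).comp z (by fun_prop))
    · intro z hz
      have n1 : R ≤ ‖z‖ := by linarith [abs_nonneg x]
      have n2 : R ≤ ‖(x : ℂ) - z‖ := by
        have := norm_sub_norm_le z (x : ℂ)
        rw [norm_sub_rev, Complex.norm_real, Real.norm_eq_abs] at this
        linarith
      have hb : ‖pC b ((x : ℂ) - z)‖ ≤ C₂ / R ^ 2 := (hb₂ _ n2).trans (by gcongr)
      calc ‖pC a z * pC b ((x : ℂ) - z)‖ ≤ C₁ / ‖z‖ ^ 2 * (C₂ / R ^ 2) := by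
            rw [norm_mul]; gcongr; exact hb₁ z n1
        _ = _ := by ring
    · rw [← hind]; exact (hint x).ofReal
  · rw [ofReal_integral_eq_lintegral_ofReal (hint x) (ae_of_all _ (hnn x)), tailMeasure_eq]
    dsimp only
    rw [lintegral_withDensity_eq_lintegral_mul _ hpm.ennreal_ofReal (by fun_prop)]
    exact lintegral_congr fun t => (ENNReal.ofReal_mul (hp.tailDensity_nonneg t)).symm

end Density

/-- Corollary 4.2 (classical case): `P₁` is closed under classical convolution. -/
theorem memP1_conv (μ₁ μ₂ : Measure ℝ)
    (h₁prob : IsProbabilityMeasure μ₁) (h₂prob : IsProbabilityMeasure μ₂)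
    (h₁ : memP1 μ₁) (h₂ : memP1 μ₂) :
    memP1 (mconv μ₁ μ₂) := by
  obtain ⟨p, a, r, R₁, H₁⟩ := h₁.exists_decomposition
  obtain ⟨q, b, s, R₂, H₂⟩ := h₂.exists_decomposition
  obtain ⟨hp, ν₁, hν₁, rfl⟩ := H₁ (max R₁ R₂) (le_max_left _ _)
  obtain ⟨hq, ν₂, hν₂, rfl⟩ := H₂ (max R₁ R₂) (le_max_right _ _)
  set R := max R₁ R₂
  have f1 : IsFiniteMeasure ν₁ :=
    isFiniteMeasure_of_le (ν₁ + tailMeasure p R) (Measure.le_add_right le_rfl)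
  have f2 : IsFiniteMeasure ν₂ :=
    isFiniteMeasure_of_le (ν₂ + tailMeasure q R) (Measure.le_add_right le_rfl)
  have f3 : IsFiniteMeasure (tailMeasure p R) :=
    isFiniteMeasure_of_le (ν₁ + tailMeasure p R) (Measure.le_add_left le_rfl)
  have f4 : IsFiniteMeasure (tailMeasure q R) :=
    isFiniteMeasure_of_le (ν₂ + tailMeasure q R) (Measure.le_add_left le_rfl)
  have hpm := hp.measurable_tailDensity.ennreal_ofReal
  have hqm := hq.measurable_tailDensity.ennreal_ofReal
  have t1 := hq.hasAnalyticTail_compact ν₁ hν₁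
  have t2 := hp.hasAnalyticTail_compact ν₂ hν₂
  have t3 := hp.hasAnalyticTail_tailMeasure hq
  have hconv : mconv (ν₁ + tailMeasure p R) (ν₂ + tailMeasure q R) =
      ν₁.conv ν₂ + volume.withDensity
        ((fun x => ∫⁻ t, ENNReal.ofReal (tailDensity q R (x - t)) ∂ν₁) +
        (fun x => ∫⁻ t, ENNReal.ofReal (tailDensity p R (x - t)) ∂ν₂) +
        fun x => ∫⁻ t, ENNReal.ofReal (tailDensity q R (x - t)) ∂(tailMeasure p R)) := by
    rw [withDensity_add_left (t1.add t2).1, withDensity_add_left t1.1, ← conv_withDensity _ hqm,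
      ← conv_withDensity _ hpm, ← conv_withDensity _ hqm, ← tailMeasure_eq, ← tailMeasure_eq,
      Measure.conv_comm ν₂]
    change (ν₁ + tailMeasure p R).conv (ν₂ + tailMeasure q R) = _
    rw [Measure.conv_add, Measure.add_conv, Measure.add_conv]
    abel
  rw [hconv]
  refine ((t1.add t2).add t3).memP1 (isCompact_Icc (a := -R + -R) (b := R + R)) ?_
  have hae : ∀ᵐ t ∂(ν₁.prod ν₂), t ∈ Icc (-R) R ×ˢ Icc (-R) R := by
    have h1 : ∀ᵐ t ∂(ν₁.prod ν₂), t.1 ∈ Icc (-R) R := Measure.quasiMeasurePreserving_fst.ae hν₁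
    have h2 : ∀ᵐ t ∂(ν₁.prod ν₂), t.2 ∈ Icc (-R) R := Measure.quasiMeasurePreserving_snd.ae hν₂
    filter_upwards [h1, h2] with t ht1 ht2 using ⟨ht1, ht2⟩
  rw [Measure.conv, Measure.map_apply (by fun_prop) measurableSet_Icc.compl]
  exact hae.mono fun t ht => ⟨add_le_add ht.1.1 ht.2.1, add_le_add ht.1.2 ht.2.2⟩
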